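/- arXiv:0904.4794 — 2 statements merged into one kernel-verified Lean document; each statement's English description precedes it below -/
import Mathlib

section
/- There exist constants C > 0 and τ₀ ≥ 1, depending only on n and Ω, such that for every real τ with |τ| ≥ τ₀ and every u ∈ C_c^∞(Ω), the interior Carleman estimate |τ| · (∫_Ω |u(x)|² dx)^{1/2} ≤ C · (∫_Ω |z(x)^{−τ} Δ(z^τ u)(x)|² dx)^{1/2} holds, where Δ(z^τ u) denotes the Euclidean Laplacian of the function x ↦ z(x)^τ u(x). -/
open MeasureTheory Complex

noncomputable section

/-- `ℝⁿ` split as `ℝ × ℝ^{n-1}`. -/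
abbrev Spc (m : ℕ) := ℝ × EuclideanSpace ℝ (Fin m)

/-- `z(x) = x₁ + i |x'|`. -/
def zf {m : ℕ} (x : Spc m) : ℂ := (x.1 : ℂ) + Complex.I * (‖x.2‖ : ℝ)

/-- The Euclidean Laplacian, as the sum of second directional derivatives along the
standard orthonormal basis of `ℝ × ℝ^m`. -/
def lap {m : ℕ} (f : Spc m → ℂ) (x : Spc m) : ℂ :=
  fderiv ℝ (fun y => fderiv ℝ f y ((1 : ℝ), 0)) x ((1 : ℝ), 0)
  + ∑ i : Fin m, fderiv ℝ (fun y => fderiv ℝ f y (0, EuclideanSpace.single i (1 : ℝ))) x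
      (0, EuclideanSpace.single i (1 : ℝ))

section Support

variable {V W F : Type*} [NormedAddCommGroup V] [NormedAddCommGroup W] [NormedAddCommGroup F]
  {w : V → W} {f : V → F}

lemma eventuallyEq_zero_of_notMem_tsupport (hf : ∀ x ∉ tsupport w, f x = 0) {x : V}
    (hx : x ∉ tsupport w) : f =ᶠ[nhds x] fun _ => 0 :=
  Filter.eventually_of_mem ((isClosed_tsupport w).isOpen_compl.mem_nhds hx) hf

lemma contDiff_of_contDiffAt_tsupport [NormedSpace ℝ V] [NormedSpace ℝ F] {n : WithTop ℕ∞}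
    (hf : ∀ x ∉ tsupport w, f x = 0)
    (h : ∀ x ∈ tsupport w, ContDiffAt ℝ n f x) : ContDiff ℝ n f := by
  refine contDiff_iff_contDiffAt.2 fun x => ?_
  by_cases hx : x ∈ tsupport w
  · exact h x hx
  · exact contDiffAt_const.congr_of_eventuallyEq (eventuallyEq_zero_of_notMem_tsupport hf hx)

lemma fderiv_eq_zero_of_notMem_tsupport [NormedSpace ℝ V] [NormedSpace ℝ F]
    (hf : ∀ x ∉ tsupport w, f x = 0) {x : V}
    (hx : x ∉ tsupport w) : fderiv ℝ f x = 0 := by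
  rw [(eventuallyEq_zero_of_notMem_tsupport hf hx).fderiv_eq]
  simp

lemma integrable_of_continuousAt_tsupport [MeasurableSpace V] [BorelSpace V]
    {μ : Measure V} [IsFiniteMeasureOnCompacts μ] (hw : HasCompactSupport w)
    (hf : ∀ x ∉ tsupport w, f x = 0) (h : ∀ x ∈ tsupport w, ContinuousAt f x) :
    Integrable f μ := by
  refine Continuous.integrable_of_hasCompactSupport ?_ (HasCompactSupport.intro hw hf)
  refine continuous_iff_continuousAt.2 fun x => ?_
  by_cases hx : x ∈ tsupport w
  · exact h x hx
  · exact continuousAt_const.congr (eventuallyEq_zero_of_notMem_tsupport hf hx).symm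

end Support

section Coordinates

variable {ι V : Type*} [NormedAddCommGroup V] [NormedSpace ℝ V]

lemma hasFDerivAt_fderiv_apply {w : V → ℝ} {x : V} (hw : ContDiff ℝ 2 w) (v : V) :
    HasFDerivAt (fun y => fderiv ℝ w y v) ((fderiv ℝ (fderiv ℝ w) x).flip v) x := by
  have h : HasFDerivAt (fderiv ℝ w) (fderiv ℝ (fderiv ℝ w) x) x :=
    ((hw.fderiv_right (m := 1) (by norm_num)).differentiable (by norm_num) x).hasFDerivAt
  simpa using h.clm_apply (hasFDerivAt_const v x)

lemma hasFDerivAt_fderiv_self {w : V → ℝ} {x : V} (hw : ContDiff ℝ 2 w) :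
    HasFDerivAt (fun y => fderiv ℝ w y y)
      (fderiv ℝ w x + (fderiv ℝ (fderiv ℝ w) x).flip x) x := by
  have h : HasFDerivAt (fderiv ℝ w) (fderiv ℝ (fderiv ℝ w) x) x :=
    ((hw.fderiv_right (m := 1) (by norm_num)).differentiable (by norm_num) x).hasFDerivAt
  simpa using h.clm_apply (hasFDerivAt_id x)

lemma hasFDerivAt_repr [FiniteDimensional ℝ V] (b : Module.Basis ι ℝ V) (i : ι) (x : V) :
    HasFDerivAt (fun y => b.repr y i) (b.coord i).toContinuousLinearMap x :=
  (b.coord i).toContinuousLinearMap.hasFDerivAt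

variable [Fintype ι]

/-- The squared Euclidean norm of `x` in the coordinates of the basis `b`. -/
def sqNorm (b : Module.Basis ι ℝ V) (x : V) : ℝ := ∑ i, b.repr x i ^ 2

/-- The Laplacian of a real function in the coordinates of the basis `b`. -/
def basisLap (b : Module.Basis ι ℝ V) (f : V → ℝ) (x : V) : ℝ :=
  ∑ i, fderiv ℝ (fun y => fderiv ℝ f y (b i)) x (b i)

/-- The squared norm of the gradient in the coordinates of the basis `b`. -/
def sqGrad (b : Module.Basis ι ℝ V) (f : V → ℝ) (x : V) : ℝ := ∑ i, fderiv ℝ f x (b i) ^ 2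

lemma sum_repr_mul_fderiv (b : Module.Basis ι ℝ V) (L : V →L[ℝ] ℝ) (x : V) :
    ∑ i, b.repr x i * L (b i) = L x := by
  conv_rhs => rw [← b.sum_repr x, map_sum]
  simp

variable [FiniteDimensional ℝ V]

lemma hasFDerivAt_sqNorm (b : Module.Basis ι ℝ V) (x : V) :
    HasFDerivAt (sqNorm b)
      (∑ i, (2 * b.repr x i) • (b.coord i).toContinuousLinearMap) x := by
  unfold sqNorm
  refine HasFDerivAt.fun_sum fun i _ => ?_
  simpa using (hasFDerivAt_repr b i x).pow 2

lemma fderiv_sqNorm_self (b : Module.Basis ι ℝ V) (x : V) :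
    fderiv ℝ (sqNorm b) x x = 2 * sqNorm b x := by
  rw [(hasFDerivAt_sqNorm b x).fderiv, sqNorm, Finset.mul_sum]
  simp only [FunLike.coe_sum, Finset.sum_apply, smul_apply,
    LinearMap.coe_toContinuousLinearMap', Module.Basis.coord_apply, smul_eq_mul]
  exact Finset.sum_congr rfl fun i _ => by ring

lemma fderiv_sqNorm_basis (b : Module.Basis ι ℝ V) (x : V) (j : ι) :
    fderiv ℝ (sqNorm b) x (b j) = 2 * b.repr x j := by
  classical
  rw [(hasFDerivAt_sqNorm b x).fderiv]
  simp [Finsupp.single_apply]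

lemma contDiff_sqNorm (b : Module.Basis ι ℝ V) {n : WithTop ℕ∞} : ContDiff ℝ n (sqNorm b) := by
  unfold sqNorm
  exact ContDiff.sum fun i _ => ((b.coord i).toContinuousLinearMap.contDiff).pow 2

section Integral

variable [MeasurableSpace V] [BorelSpace V] (μ : Measure V) [μ.IsAddHaarMeasure]

lemma integral_euler (b : Module.Basis ι ℝ V) {f : V → ℝ} (hf : ContDiff ℝ 1 f)
    (hc : HasCompactSupport f) :
    Integrable (fun x => Fintype.card ι * f x + fderiv ℝ f x x) μ ∧
    ∫ x, (Fintype.card ι * f x + fderiv ℝ f x x) ∂μ = 0 := by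
  have hr : ∀ i, Continuous fun x => b.repr x i := fun i =>
    (b.coord i).toContinuousLinearMap.continuous
  have hd : Continuous (fderiv ℝ f) := hf.continuous_fderiv (by norm_num)
  have hif : Integrable f μ := hf.continuous.integrable_of_hasCompactSupport hc
  have hi : ∀ i, Integrable (fun x => b.repr x i * fderiv ℝ f x (b i)) μ := fun i =>
    ((hr i).mul (hd.clm_apply continuous_const)).integrable_of_hasCompactSupport
      ((hc.fderiv_apply ℝ (b i)).mul_left)
  have key : ∀ i, ∫ x, b.repr x i * fderiv ℝ f x (b i) ∂μ = - ∫ x, f x ∂μ := by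
    intro i
    have h1 : ∀ x, fderiv ℝ (fun y => b.repr y i) x (b i) * f x = f x := fun x => by
      rw [(hasFDerivAt_repr b i x).fderiv]; simp
    rw [integral_mul_fderiv_eq_neg_fderiv_mul_of_integrable]
    · simp only [h1]
    · simpa only [h1] using hif
    · exact hi i
    · exact ((hr i).mul hf.continuous).integrable_of_hasCompactSupport hc.mul_left
    · exact fun x _ => (hasFDerivAt_repr b i x).differentiableAt
    · exact fun x _ => hf.differentiable (by norm_num) x
  have hs : (fun x => fderiv ℝ f x x) = fun x => ∑ i, b.repr x i * fderiv ℝ f x (b i) := by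
    ext x; rw [sum_repr_mul_fderiv]
  have hI : Integrable (fun x => fderiv ℝ f x x) μ := by
    rw [hs]; exact integrable_finsetSum _ fun i _ => hi i
  refine ⟨(hif.const_mul _).add hI, ?_⟩
  rw [integral_add (hif.const_mul _) hI, hs, integral_finsetSum _ fun i _ => hi i,
    integral_const_mul]
  simp [key]

lemma integral_green (b : Module.Basis ι ℝ V) {g w : V → ℝ} (hg : ContDiff ℝ 1 g)
    (hc : HasCompactSupport g) (hw : ContDiff ℝ 2 w) :
    Integrable (fun x => g x * basisLap b w x + ∑ i, fderiv ℝ g x (b i) * fderiv ℝ w x (b i)) μ ∧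
    ∫ x, (g x * basisLap b w x + ∑ i, fderiv ℝ g x (b i) * fderiv ℝ w x (b i)) ∂μ = 0 := by
  have hd : Continuous (fderiv ℝ g) := hg.continuous_fderiv (by norm_num)
  have hw' : ∀ i, ContDiff ℝ 1 fun x => fderiv ℝ w x (b i) := fun i =>
    (hw.fderiv_right (by norm_num)).clm_apply contDiff_const
  have h1 : ∀ i, Integrable (fun x => g x * fderiv ℝ (fun y => fderiv ℝ w y (b i)) x (b i)) μ :=
    fun i => (hg.continuous.mul (((hw' i).continuous_fderiv (by norm_num)).clm_apply
      continuous_const)).integrable_of_hasCompactSupport hc.mul_right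
  have h2 : ∀ i, Integrable (fun x => fderiv ℝ g x (b i) * fderiv ℝ w x (b i)) μ :=
    fun i => ((hd.clm_apply continuous_const).mul
      (hw' i).continuous).integrable_of_hasCompactSupport (hc.fderiv_apply ℝ (b i)).mul_right
  have h3 : ∀ i, ∫ x, g x * fderiv ℝ (fun y => fderiv ℝ w y (b i)) x (b i) ∂μ
      = - ∫ x, fderiv ℝ g x (b i) * fderiv ℝ w x (b i) ∂μ := fun i =>
    integral_mul_fderiv_eq_neg_fderiv_mul_of_integrable (h2 i) (h1 i)
      ((hg.continuous.mul (hw' i).continuous).integrable_of_hasCompactSupport hc.mul_right)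
      (fun x _ => hg.differentiable (by norm_num) x)
      (fun x _ => (hw' i).differentiable (by norm_num) x)
  have hs : (fun x => g x * basisLap b w x + ∑ i, fderiv ℝ g x (b i) * fderiv ℝ w x (b i))
      = fun x => ∑ i, (g x * fderiv ℝ (fun y => fderiv ℝ w y (b i)) x (b i)
        + fderiv ℝ g x (b i) * fderiv ℝ w x (b i)) := by
    ext x; rw [basisLap, Finset.mul_sum, Finset.sum_add_distrib]
  have h12 : ∀ i ∈ Finset.univ, Integrable (fun x =>
      g x * fderiv ℝ (fun y => fderiv ℝ w y (b i)) x (b i)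
        + fderiv ℝ g x (b i) * fderiv ℝ w x (b i)) μ := fun i _ => (h1 i).add (h2 i)
  rw [hs]
  refine ⟨integrable_finsetSum _ h12, ?_⟩
  rw [integral_finsetSum _ h12]
  refine Finset.sum_eq_zero fun i _ => ?_
  rw [integral_add (h1 i) (h2 i), h3 i]
  ring

end Integral

section Pointwise

variable {b : Module.Basis ι ℝ V} {w : V → ℝ} {x : V}

lemma hasFDerivAt_sqNorm_rpow (hx : 0 < sqNorm b x) (κ : ℝ) :
    HasFDerivAt (fun y => sqNorm b y ^ κ)
      ((κ * sqNorm b x ^ (κ - 1)) • fderiv ℝ (sqNorm b) x) x :=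
  (hasFDerivAt_sqNorm b x).differentiableAt.hasFDerivAt.rpow_const (Or.inl hx.ne')

lemma fderiv_rpow_mul_sq_self (hx : 0 < sqNorm b x) (hw : ContDiff ℝ 2 w) (κ : ℝ) :
    fderiv ℝ (fun y => sqNorm b y ^ κ * w y ^ 2) x x =
      2 * κ * (sqNorm b x ^ κ * w x ^ 2) + 2 * sqNorm b x ^ κ * w x * fderiv ℝ w x x := by
  have hw' := (hw.differentiable (by norm_num) x).hasFDerivAt
  rw [((hasFDerivAt_sqNorm_rpow hx κ).fun_mul (hw'.pow 2)).fderiv]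
  simp only [add_apply, smul_apply, fderiv_sqNorm_self, smul_eq_mul]
  rw [Real.rpow_sub_one hx.ne']
  field_simp
  ring

lemma fderiv_log_mul_rpow_mul_sq_self (hx : 0 < sqNorm b x) (hw : ContDiff ℝ 2 w) (κ : ℝ) :
    fderiv ℝ (fun y => Real.log (sqNorm b y) * (sqNorm b y ^ κ * w y ^ 2)) x x =
      2 * (sqNorm b x ^ κ * w x ^ 2) + Real.log (sqNorm b x) *
        (2 * κ * (sqNorm b x ^ κ * w x ^ 2) + 2 * sqNorm b x ^ κ * w x * fderiv ℝ w x x) := by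
  have hw' := (hw.differentiable (by norm_num) x).hasFDerivAt
  have h := ((hasFDerivAt_sqNorm_rpow hx κ).fun_mul (hw'.pow 2)).differentiableAt.hasFDerivAt
  rw [← fderiv_rpow_mul_sq_self hx hw]
  rw [(((hasFDerivAt_sqNorm b x).differentiableAt.hasFDerivAt.log hx.ne').fun_mul h).fderiv]
  simp only [add_apply, smul_apply, fderiv_sqNorm_self, smul_eq_mul]
  field_simp
  ring

lemma fderiv_rpow_mul_sqGrad_self (hx : 0 < sqNorm b x) (hw : ContDiff ℝ 2 w) (κ : ℝ) :
    fderiv ℝ (fun y => sqNorm b y ^ κ * sqGrad b w y) x x =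
      2 * κ * sqNorm b x ^ κ * sqGrad b w x + 2 * sqNorm b x ^ κ *
        ∑ i, fderiv ℝ w x (b i) * fderiv ℝ (fderiv ℝ w) x x (b i) := by
  have hN : HasFDerivAt (sqGrad b w) (∑ i, (2 * fderiv ℝ w x (b i)) •
      (fderiv ℝ (fderiv ℝ w) x).flip (b i)) x := by
    unfold sqGrad
    refine HasFDerivAt.fun_sum fun i _ => ?_
    simpa using (hasFDerivAt_fderiv_apply hw (b i)).pow 2
  rw [((hasFDerivAt_sqNorm_rpow hx κ).fun_mul hN).fderiv]
  simp only [add_apply, smul_apply, fderiv_sqNorm_self, smul_eq_mul, FunLike.coe_sum,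
    Finset.sum_apply, ContinuousLinearMap.flip_apply, mul_assoc, ← Finset.mul_sum]
  rw [Real.rpow_sub_one hx.ne']
  field_simp
  ring

lemma sum_fderiv_rpow_mul_mul_fderiv (hx : 0 < sqNorm b x) (hw : ContDiff ℝ 2 w) (κ τ : ℝ) :
    ∑ i, fderiv ℝ (fun y => sqNorm b y ^ (κ + 1) * (fderiv ℝ w y y - τ * w y)) x (b i) *
        fderiv ℝ w x (b i) =
      2 * (κ + 1) * sqNorm b x ^ κ * (fderiv ℝ w x x - τ * w x) * fderiv ℝ w x x +
      sqNorm b x ^ (κ + 1) * ((1 - τ) * sqGrad b w x +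
        ∑ i, fderiv ℝ w x (b i) * fderiv ℝ (fderiv ℝ w) x x (b i)) := by
  have hw' := (hw.differentiable (by norm_num) x).hasFDerivAt
  have hsymm : IsSymmSndFDerivAt ℝ w x := hw.contDiffAt.isSymmSndFDerivAt (by simp)
  rw [((hasFDerivAt_sqNorm_rpow hx (κ + 1)).fun_mul
    ((hasFDerivAt_fderiv_self hw).fun_sub (hw'.const_mul τ))).fderiv]
  simp only [add_apply, smul_apply, sub_apply, fderiv_sqNorm_basis, smul_eq_mul,
    ContinuousLinearMap.flip_apply, hsymm _ x, add_sub_cancel_right]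
  have key : ∀ i, (sqNorm b x ^ (κ + 1) * (fderiv ℝ w x (b i) +
        fderiv ℝ (fderiv ℝ w) x x (b i) - τ * fderiv ℝ w x (b i)) +
      (fderiv ℝ w x x - τ * w x) * ((κ + 1) * sqNorm b x ^ κ * (2 * b.repr x i))) *
        fderiv ℝ w x (b i) =
      2 * (κ + 1) * sqNorm b x ^ κ * (fderiv ℝ w x x - τ * w x) *
        (b.repr x i * fderiv ℝ w x (b i)) +
      sqNorm b x ^ (κ + 1) * ((1 - τ) * fderiv ℝ w x (b i) ^ 2 +
        fderiv ℝ w x (b i) * fderiv ℝ (fderiv ℝ w) x x (b i)) := fun i => by ring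
  simp only [key, Finset.sum_add_distrib, ← Finset.mul_sum, sum_repr_mul_fderiv, sqGrad]

end Pointwise

section Estimate

variable [MeasurableSpace V] [BorelSpace V] (μ : Measure V) [μ.IsAddHaarMeasure]
  (b : Module.Basis ι ℝ V) {w : V → ℝ}

lemma integral_pohozaev (hw : ContDiff ℝ 2 w) (hc : HasCompactSupport w)
    (h0 : ∀ x ∈ tsupport w, 0 < sqNorm b x) {κ τ : ℝ}
    (hκ : 2 * κ = -2 * τ - Fintype.card ι) :
    Integrable (fun x => sqNorm b x ^ (κ + 1) * (fderiv ℝ w x x - τ * w x) * basisLap b w x -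
      (2 * τ + Fintype.card ι - 2) *
        (sqNorm b x ^ κ * (fderiv ℝ w x x - τ * w x) ^ 2)) μ ∧
    ∫ x, (sqNorm b x ^ (κ + 1) * (fderiv ℝ w x x - τ * w x) * basisLap b w x -
      (2 * τ + Fintype.card ι - 2) *
        (sqNorm b x ^ κ * (fderiv ℝ w x x - τ * w x) ^ 2)) ∂μ = 0 := by
  have hw1 : ContDiff ℝ 1 w := hw.of_le (by norm_num)
  have hdw : ContDiff ℝ 1 (fderiv ℝ w) := hw.fderiv_right (by norm_num)
  have hs : ∀ x ∈ tsupport w, ContDiffAt ℝ 1 (fun y => sqNorm b y ^ (κ + 1)) x := fun x hx =>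
    (contDiff_sqNorm b).contDiffAt.rpow_const_of_ne (h0 x hx).ne'
  have w0 : ∀ x ∉ tsupport w, w x = 0 := fun x hx => image_eq_zero_of_notMem_tsupport hx
  have d0 : ∀ x ∉ tsupport w, fderiv ℝ w x = 0 := fun x hx => fderiv_of_notMem_tsupport ℝ hx
  have zg : ∀ x ∉ tsupport w, sqNorm b x ^ (κ + 1) * (fderiv ℝ w x x - τ * w x) = 0 :=
    fun x hx => by simp [w0 x hx, d0 x hx]
  have zh : ∀ x ∉ tsupport w, sqNorm b x ^ (κ + 1) * sqGrad b w x = 0 :=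
    fun x hx => by simp [sqGrad, d0 x hx]
  have zp : ∀ x ∉ tsupport w, sqNorm b x ^ κ * w x ^ 2 = 0 := fun x hx => by simp [w0 x hx]
  obtain ⟨hG, hG0⟩ := integral_green μ b
    (contDiff_of_contDiffAt_tsupport zg fun x hx => (hs x hx).mul
      ((hdw.clm_apply contDiff_id).sub (contDiff_const.mul hw1)).contDiffAt)
    (HasCompactSupport.intro hc zg) hw
  obtain ⟨hH, hH0⟩ := integral_euler μ b
    (contDiff_of_contDiffAt_tsupport zh fun x hx => (hs x hx).mul
      (ContDiff.sum fun i _ => (hdw.clm_apply contDiff_const).pow 2).contDiffAt)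
    (HasCompactSupport.intro hc zh)
  obtain ⟨hP, hP0⟩ := integral_euler μ b
    (contDiff_of_contDiffAt_tsupport zp fun x hx =>
      ((contDiff_sqNorm b).contDiffAt.rpow_const_of_ne (h0 x hx).ne').mul (hw1.contDiffAt.pow 2))
    (HasCompactSupport.intro hc zp)
  have hH' := hH.const_mul (1 / 2)
  have hP' := hP.const_mul ((2 * τ + Fintype.card ι - 2) * τ / 2)
  have key := integral_add (hG.sub hH') hP'
  simp only [Pi.sub_apply] at key
  rw [integral_sub hG hH', integral_const_mul, integral_const_mul, hG0, hH0, hP0] at key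
  suffices h : (fun x => sqNorm b x ^ (κ + 1) * (fderiv ℝ w x x - τ * w x) * basisLap b w x -
      (2 * τ + Fintype.card ι - 2) * (sqNorm b x ^ κ * (fderiv ℝ w x x - τ * w x) ^ 2)) = _ by
    rw [h]
    exact ⟨(hG.sub hH').add hP', key.trans (by simp)⟩
  ext x
  simp only [Pi.add_apply, Pi.sub_apply]
  by_cases hx : x ∈ tsupport w
  · rw [fderiv_rpow_mul_sq_self (h0 x hx) hw, fderiv_rpow_mul_sqGrad_self (h0 x hx) hw,
      sum_fderiv_rpow_mul_mul_fderiv (h0 x hx) hw]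
    obtain rfl : κ = -τ - Fintype.card ι / 2 := by linarith
    ring
  · rw [fderiv_eq_zero_of_notMem_tsupport zh hx, fderiv_eq_zero_of_notMem_tsupport zp hx, zp x hx,
      zh x hx, zg x hx, w0 x hx, d0 x hx]
    simp

lemma integral_log_mul (hw : ContDiff ℝ 2 w) (hc : HasCompactSupport w)
    (h0 : ∀ x ∈ tsupport w, 0 < sqNorm b x) {κ τ : ℝ}
    (hκ : 2 * κ = -2 * τ - Fintype.card ι) :
    Integrable (fun x => sqNorm b x ^ κ * w x ^ 2 + Real.log (sqNorm b x) *
      (sqNorm b x ^ κ * (w x * (fderiv ℝ w x x - τ * w x)))) μ ∧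
    ∫ x, (sqNorm b x ^ κ * w x ^ 2 + Real.log (sqNorm b x) *
      (sqNorm b x ^ κ * (w x * (fderiv ℝ w x x - τ * w x)))) ∂μ = 0 := by
  have hw1 : ContDiff ℝ 1 w := hw.of_le (by norm_num)
  have w0 : ∀ x ∉ tsupport w, w x = 0 := fun x hx => image_eq_zero_of_notMem_tsupport hx
  have zl : ∀ x ∉ tsupport w, Real.log (sqNorm b x) * (sqNorm b x ^ κ * w x ^ 2) = 0 :=
    fun x hx => by simp [w0 x hx]
  obtain ⟨hL, hL0⟩ := integral_euler μ b
    (contDiff_of_contDiffAt_tsupport zl fun x hx =>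
      ((contDiff_sqNorm b).contDiffAt.log (h0 x hx).ne').mul
        (((contDiff_sqNorm b).contDiffAt.rpow_const_of_ne (h0 x hx).ne').mul
          (hw1.contDiffAt.pow 2)))
    (HasCompactSupport.intro hc zl)
  have key := integral_const_mul (μ := μ) (1 / 2 : ℝ) (fun x => Fintype.card ι *
    (Real.log (sqNorm b x) * (sqNorm b x ^ κ * w x ^ 2)) +
      fderiv ℝ (fun y => Real.log (sqNorm b y) * (sqNorm b y ^ κ * w y ^ 2)) x x)
  rw [hL0, mul_zero] at key
  suffices h : (fun x => sqNorm b x ^ κ * w x ^ 2 + Real.log (sqNorm b x) *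
      (sqNorm b x ^ κ * (w x * (fderiv ℝ w x x - τ * w x)))) = _ by
    rw [h]
    exact ⟨hL.const_mul (1 / 2), key⟩
  ext x
  by_cases hx : x ∈ tsupport w
  · rw [fderiv_log_mul_rpow_mul_sq_self (h0 x hx) hw]
    obtain rfl : κ = -τ - Fintype.card ι / 2 := by linarith
    ring
  · rw [fderiv_eq_zero_of_notMem_tsupport zl hx, zl x hx, w0 x hx]
    simp

lemma sq_mul_integral_sq_le (hw : ContDiff ℝ 2 w) (hc : HasCompactSupport w)
    (h0 : ∀ x ∈ tsupport w, 0 < sqNorm b x) {κ τ : ℝ}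
    (hκ : 2 * κ = -2 * τ - Fintype.card ι) {M : ℝ} (hM0 : 0 ≤ M)
    (hM : ∀ x ∈ tsupport w, Real.log (sqNorm b x) ^ 2 ≤ M) :
    Integrable (fun x => sqNorm b x ^ κ * w x ^ 2) μ ∧
    Integrable (fun x => sqNorm b x ^ κ * (sqNorm b x * basisLap b w x) ^ 2) μ ∧
    (2 * τ + Fintype.card ι - 2) ^ 2 * ∫ x, sqNorm b x ^ κ * w x ^ 2 ∂μ ≤
      M * ∫ x, sqNorm b x ^ κ * (sqNorm b x * basisLap b w x) ^ 2 ∂μ := by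
  obtain ⟨hF, hF0⟩ := integral_pohozaev μ b hw hc h0 hκ
  obtain ⟨hL, hL0⟩ := integral_log_mul μ b hw hc h0 hκ
  set K : ℝ := 2 * τ + Fintype.card ι - 2
  have w0 : ∀ x ∉ tsupport w, w x = 0 := fun x hx => image_eq_zero_of_notMem_tsupport hx
  have d0 : ∀ x ∉ tsupport w, fderiv ℝ w x = 0 := fun x hx => fderiv_of_notMem_tsupport ℝ hx
  have hdw : ContDiff ℝ 1 (fderiv ℝ w) := hw.fderiv_right (by norm_num)
  have dd0 : ∀ x ∉ tsupport w, basisLap b w x = 0 := fun x hx =>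
    Finset.sum_eq_zero fun i _ => by
      rw [fderiv_eq_zero_of_notMem_tsupport (fun y hy => by simp [d0 y hy]) hx]; simp
  have hs : Continuous (sqNorm b) := (contDiff_sqNorm b (n := 0)).continuous
  have hρ : ∀ x ∈ tsupport w, ContinuousAt (fun y => sqNorm b y ^ κ) x := fun x hx =>
    hs.continuousAt.rpow_const (Or.inl (h0 x hx).ne')
  have hlap : Continuous (basisLap b w) := continuous_finsetSum _ fun i _ =>
    ((hdw.clm_apply contDiff_const).continuous_fderiv (by norm_num)).clm_apply continuous_const
  have hA : Integrable (fun x => sqNorm b x ^ κ * w x ^ 2) μ :=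
    integrable_of_continuousAt_tsupport hc (fun x hx => by simp [w0 x hx])
      fun x hx => (hρ x hx).mul (hw.continuous.pow 2).continuousAt
  have hQ : Integrable (fun x => sqNorm b x ^ κ * (fderiv ℝ w x x - τ * w x) ^ 2) μ :=
    integrable_of_continuousAt_tsupport hc (fun x hx => by simp [w0 x hx, d0 x hx])
      fun x hx => (hρ x hx).mul (((hdw.continuous.clm_apply continuous_id).sub
        (hw.continuous.const_mul τ)).pow 2).continuousAt
  have hB : Integrable (fun x => sqNorm b x ^ κ * (sqNorm b x * basisLap b w x) ^ 2) μ :=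
    integrable_of_continuousAt_tsupport hc (fun x hx => by simp [dd0 x hx])
      fun x hx => (hρ x hx).mul ((hs.mul hlap).pow 2).continuousAt
  have h1 := integral_mono (hF.const_mul K) ((hB.const_mul (1 / 2)).sub (hQ.const_mul (K ^ 2 / 2)))
    fun x => by
      simp only [Pi.sub_apply]
      by_cases hx : x ∈ tsupport w
      · rw [Real.rpow_add_one (h0 x hx).ne']
        have := mul_nonneg (Real.rpow_nonneg (h0 x hx).le κ)
          (sq_nonneg (sqNorm b x * basisLap b w x - K * (fderiv ℝ w x x - τ * w x)))
        linarith
      · simp [w0 x hx, d0 x hx, dd0 x hx]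
  have h2 := integral_mono ((hA.const_mul (1 / 2)).sub (hQ.const_mul (M / 2))) hL fun x => by
    simp only [Pi.sub_apply]
    by_cases hx : x ∈ tsupport w
    · have hr := Real.rpow_nonneg (h0 x hx).le κ
      have := mul_nonneg hr
        (sq_nonneg (w x + Real.log (sqNorm b x) * (fderiv ℝ w x x - τ * w x)))
      have := mul_le_mul_of_nonneg_left (hM x hx)
        (mul_nonneg hr (sq_nonneg (fderiv ℝ w x x - τ * w x)))
      linarith
    · simp [w0 x hx, d0 x hx]
  rw [integral_const_mul, hF0] at h1
  rw [hL0] at h2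
  simp only [Pi.sub_apply] at h1 h2
  rw [integral_sub (hB.const_mul _) (hQ.const_mul _), integral_const_mul, integral_const_mul] at h1
  rw [integral_sub (hA.const_mul _) (hQ.const_mul _), integral_const_mul, integral_const_mul] at h2
  refine ⟨hA, hB, ?_⟩
  nlinarith [mul_le_mul_of_nonneg_left h2 (sq_nonneg K), mul_le_mul_of_nonneg_left h1 hM0]

end Estimate

end Coordinates

section Split

variable {m : ℕ}

/-- The standard basis of `ℝ × ℝ^m`. -/
def spcBasis (m : ℕ) : Module.Basis (Unit ⊕ Fin m) ℝ (Spc m) :=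
  (Module.Basis.singleton Unit ℝ).prod (EuclideanSpace.basisFun (Fin m) ℝ).toBasis

lemma spcBasis_inl : spcBasis m (Sum.inl ()) = ((1 : ℝ), 0) := by
  simp [spcBasis]

lemma spcBasis_inr (i : Fin m) :
    spcBasis m (Sum.inr i) = (0, EuclideanSpace.single i (1 : ℝ)) := by
  simp [spcBasis]

lemma sqNorm_spcBasis (x : Spc m) : sqNorm (spcBasis m) x = ‖zf x‖ ^ 2 := by
  rw [← Complex.normSq_eq_norm_sq]
  simp [sqNorm, spcBasis, zf, Complex.normSq_apply, EuclideanSpace.real_norm_sq_eq, ← sq]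

lemma sqNorm_spcBasis_pos {x : Spc m} (hx : x.2 ≠ 0) : 0 < sqNorm (spcBasis m) x := by
  have h : zf x ≠ 0 := fun h => hx (by simpa [zf] using congrArg Complex.im h)
  rw [sqNorm_spcBasis]
  positivity

lemma contDiffAt_zf_cpow {x : Spc m} (hx : x.2 ≠ 0) (τ : ℂ) {k : WithTop ℕ∞} :
    ContDiffAt ℝ k (fun y : Spc m => zf y ^ τ) x := by
  have hz : zf x ∈ Complex.slitPlane := Or.inr (by simpa [zf] using hx)
  have h1 : ContDiffAt ℝ k (fun z : ℂ => z ^ τ) (zf x) :=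
    ((analyticAt_id.cpow analyticAt_const hz).contDiffAt (n := k)).restrict_scalars ℝ
  have h2 : ContDiffAt ℝ k (fun y : Spc m => zf y) x :=
    (Complex.ofRealCLM.contDiff.contDiffAt.comp x contDiffAt_fst).add
      (contDiffAt_const.mul (Complex.ofRealCLM.contDiff.contDiffAt.comp x
        (contDiffAt_snd.norm ℝ hx)))
  exact h1.comp x h2

lemma lap_eq_sum (f : Spc m → ℂ) (x : Spc m) :
    lap f x = ∑ i, fderiv ℝ (fun y => fderiv ℝ f y (spcBasis m i)) x (spcBasis m i) := by
  simp [lap, spcBasis_inl, spcBasis_inr]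

lemma continuous_lap {f : Spc m → ℂ} (hf : ContDiff ℝ 2 f) : Continuous (lap f) := by
  have hdf : ContDiff ℝ 1 (fderiv ℝ f) := hf.fderiv_right (by norm_num)
  simp only [funext (lap_eq_sum f)]
  exact continuous_finsetSum _ fun i _ =>
    ((hdf.clm_apply contDiff_const).continuous_fderiv (by norm_num)).clm_apply continuous_const

lemma lap_eq_zero_of_notMem_tsupport {f : Spc m → ℂ} {x : Spc m} (hx : x ∉ tsupport f) :
    lap f x = 0 := by
  rw [lap_eq_sum]
  refine Finset.sum_eq_zero fun i _ => ?_
  rw [fderiv_eq_zero_of_notMem_tsupport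
    (fun y hy => by simp [fderiv_of_notMem_tsupport ℝ hy]) hx]
  simp

lemma clm_lap (L : ℂ →L[ℝ] ℝ) {f : Spc m → ℂ} (hf : ContDiff ℝ 2 f) (x : Spc m) :
    L (lap f x) = basisLap (spcBasis m) (fun y => L (f y)) x := by
  have hdf : ContDiff ℝ 1 (fderiv ℝ f) := hf.fderiv_right (by norm_num)
  have h : ∀ (g : Spc m → ℂ) y v, DifferentiableAt ℝ g y →
      fderiv ℝ (fun y => L (g y)) y v = L (fderiv ℝ g y v) := fun g y v hg =>
    DFunLike.congr_fun (L.hasFDerivAt.comp y hg.hasFDerivAt).fderiv v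
  have h1 : ∀ y v, fderiv ℝ (fun y => L (f y)) y v = L (fderiv ℝ f y v) := fun y v =>
    h f y v (hf.differentiable (by norm_num) y)
  have h2 : ∀ v, fderiv ℝ (fun y => L (fderiv ℝ f y v)) x v
      = L (fderiv ℝ (fun y => fderiv ℝ f y v) x v) := fun v =>
    h _ x v ((hdf.clm_apply contDiff_const).differentiable (by norm_num) x)
  simp only [lap_eq_sum, map_sum, basisLap, h1, h2]

lemma sq_mul_integral_norm_sq_le {f : Spc m → ℂ} (hf : ContDiff ℝ 2 f) (hc : HasCompactSupport f)
    (h0 : ∀ x ∈ tsupport f, 0 < sqNorm (spcBasis m) x) {κ τ M : ℝ}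
    (hκ : 2 * κ = -2 * τ - (1 + m)) (hM0 : 0 ≤ M)
    (hM : ∀ x ∈ tsupport f, Real.log (sqNorm (spcBasis m) x) ^ 2 ≤ M) :
    Integrable (fun x => sqNorm (spcBasis m) x ^ κ * ‖f x‖ ^ 2) ∧
    Integrable (fun x => sqNorm (spcBasis m) x ^ κ * (sqNorm (spcBasis m) x * ‖lap f x‖) ^ 2) ∧
    (2 * τ + m - 1) ^ 2 * ∫ x, sqNorm (spcBasis m) x ^ κ * ‖f x‖ ^ 2 ≤
      M * ∫ x, sqNorm (spcBasis m) x ^ κ * (sqNorm (spcBasis m) x * ‖lap f x‖) ^ 2 := by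
  have : (volume : Measure (Spc m)).IsAddHaarMeasure :=
    inferInstanceAs ((volume.prod volume : Measure (Spc m)).IsAddHaarMeasure)
  have hsub : ∀ L : ℂ →L[ℝ] ℝ, tsupport (fun x => L (f x)) ⊆ tsupport f := fun L =>
    closure_mono fun x hx hfx => hx (by simp [hfx])
  have key := fun L : ℂ →L[ℝ] ℝ =>
    sq_mul_integral_sq_le (volume : Measure (Spc m)) (spcBasis m) (L.contDiff.comp hf)
      (hc.comp_left (map_zero L)) (fun x hx => h0 x (hsub L hx)) (κ := κ) (τ := τ)
      (by rw [hκ]; simp) hM0 (fun x hx => hM x (hsub L hx))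
  obtain ⟨a1, b1, c1⟩ := key Complex.reCLM
  obtain ⟨a2, b2, c2⟩ := key Complex.imCLM
  have e1 : (fun x => sqNorm (spcBasis m) x ^ κ * ‖f x‖ ^ 2) = fun x =>
      sqNorm (spcBasis m) x ^ κ * (Complex.reCLM ∘ f) x ^ 2 +
      sqNorm (spcBasis m) x ^ κ * (Complex.imCLM ∘ f) x ^ 2 := by
    ext x
    rw [← Complex.normSq_eq_norm_sq, Complex.normSq_apply]
    simp only [Function.comp_apply, Complex.reCLM_apply, Complex.imCLM_apply]
    ring
  have e2 : (fun x => sqNorm (spcBasis m) x ^ κ * (sqNorm (spcBasis m) x * ‖lap f x‖) ^ 2) =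
      fun x => sqNorm (spcBasis m) x ^ κ *
        (sqNorm (spcBasis m) x * basisLap (spcBasis m) (Complex.reCLM ∘ f) x) ^ 2 +
      sqNorm (spcBasis m) x ^ κ *
        (sqNorm (spcBasis m) x * basisLap (spcBasis m) (Complex.imCLM ∘ f) x) ^ 2 := by
    ext x
    have r1 := clm_lap Complex.reCLM hf x
    have r2 := clm_lap Complex.imCLM hf x
    simp only [Function.comp_def]
    rw [← r1, ← r2, mul_pow, ← Complex.normSq_eq_norm_sq, Complex.normSq_apply]
    simp only [Complex.reCLM_apply, Complex.imCLM_apply]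
    ring
  rw [e1, e2, integral_add a1 a2, integral_add b1 b2]
  refine ⟨a1.add a2, b1.add b2, ?_⟩
  have hK : (2 * τ + Fintype.card (Unit ⊕ Fin m) - 2 : ℝ) = 2 * τ + m - 1 := by
    simp; ring
  rw [hK] at c1 c2
  linarith

theorem exists_carleman_constant {Ω : Set (Spc m)} (hΩne : Ω.Nonempty)
    (hΩbdd : Bornology.IsBounded Ω) (hΩline : ∀ x ∈ closure Ω, x.2 ≠ 0) :
    ∃ C > (0 : ℝ), ∃ τ₀ ≥ (1 : ℝ), ∀ τ : ℝ, τ₀ ≤ |τ| →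
      ∀ u : Spc m → ℂ, ContDiff ℝ (⊤ : ℕ∞) u → HasCompactSupport u → tsupport u ⊆ Ω →
        |τ| * Real.sqrt (∫ x in Ω, ‖u x‖ ^ 2) ≤
          C * Real.sqrt (∫ x in Ω,
            ‖zf x ^ (-(τ : ℂ)) * lap (fun y => zf y ^ (τ : ℂ) * u y) x‖ ^ 2) := by
  set s : Spc m → ℝ := sqNorm (spcBasis m) with hs
  have hpos : ∀ x ∈ closure Ω, 0 < s x := fun x hx => sqNorm_spcBasis_pos (hΩline x hx)
  have hcont : Continuous s := (contDiff_sqNorm (spcBasis m) (n := 0)).continuous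
  have hcpt : IsCompact (closure Ω) := hΩbdd.isCompact_closure
  have hrpow : ∀ p : ℝ, ContinuousOn (fun x => s x ^ p) (closure Ω) := fun p =>
    hcont.continuousOn.rpow_const fun x hx => Or.inl (hpos x hx).ne'
  obtain ⟨D, hD⟩ := hcpt.exists_bound_of_continuousOn (hrpow ((1 + m) / 2))
  obtain ⟨E, hE⟩ := hcpt.exists_bound_of_continuousOn (hrpow (2 - (1 + m) / 2))
  obtain ⟨M, hM⟩ := hcpt.exists_bound_of_continuousOn
    ((hcont.continuousOn.log fun x hx => (hpos x hx).ne').pow 2)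
  obtain ⟨x₀, hx₀⟩ := hΩne
  have hD0 : 0 ≤ D := (norm_nonneg _).trans (hD x₀ (subset_closure hx₀))
  have hE0 : 0 ≤ E := (norm_nonneg _).trans (hE x₀ (subset_closure hx₀))
  have hM0 : 0 ≤ M := (norm_nonneg _).trans (hM x₀ (subset_closure hx₀))
  refine ⟨Real.sqrt (D * M * E + 1), by positivity, m + 1, by simp, fun τ hτ u hu huc hut => ?_⟩
  set W : Spc m → ℂ := fun y => zf y ^ (τ : ℂ) * u y with hW
  have hsub : tsupport W ⊆ tsupport u := closure_mono fun x hx hux => hx (by simp [W, hux])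
  have hcl : tsupport W ⊆ closure Ω := hsub.trans (hut.trans subset_closure)
  have hW0 : ∀ x ∉ tsupport u, W x = 0 := fun x hx => by
    simp [W, image_eq_zero_of_notMem_tsupport hx]
  have hWs : ContDiff ℝ 2 W := contDiff_of_contDiffAt_tsupport hW0 fun x hx =>
    (contDiffAt_zf_cpow (hΩline x (subset_closure (hut hx))) τ).mul
      (contDiff_infty.1 hu 2).contDiffAt
  have hWc : HasCompactSupport W := HasCompactSupport.intro huc hW0
  obtain ⟨hA, hB, hAB⟩ := sq_mul_integral_norm_sq_le hWs hWc (fun x hx => hpos x (hcl hx))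
    (κ := -τ - (1 + m) / 2) (τ := τ) (by ring) hM0
    (fun x hx => (le_abs_self _).trans (hM x (hcl hx)))
  have hnorm : ∀ (x : Spc m) (t : ℝ), ‖zf x ^ (t : ℂ)‖ ^ 2 = s x ^ t := fun x t => by
    rw [Complex.norm_cpow_real, hs, sqNorm_spcBasis, ← Real.rpow_natCast, ← Real.rpow_natCast,
      ← Real.rpow_mul (norm_nonneg _), ← Real.rpow_mul (norm_nonneg _), mul_comm]
  have hleft : ∫ x in Ω, ‖u x‖ ^ 2 ≤ D * ∫ x, s x ^ (-τ - (1 + m) / 2) * ‖W x‖ ^ 2 := by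
    have hz : ∀ x ∉ tsupport u, ‖u x‖ ^ 2 = 0 := fun x hx => by
      simp [image_eq_zero_of_notMem_tsupport hx]
    rw [setIntegral_eq_integral_of_forall_compl_eq_zero fun x hx => hz x fun h => hx (hut h),
      ← integral_const_mul]
    refine integral_mono_of_nonneg (.of_forall fun x => by positivity) (hA.const_mul D)
      (.of_forall fun x => ?_)
    by_cases hx : x ∈ tsupport u
    · have hxc : x ∈ closure Ω := subset_closure (hut hx)
      have h1 : s x ^ (-τ - (1 + m) / 2) * ‖W x‖ ^ 2 * s x ^ ((1 + m : ℝ) / 2) = ‖u x‖ ^ 2 := by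
        rw [norm_mul, mul_pow, hnorm]
        calc _ = s x ^ (-τ - (1 + m) / 2) * s x ^ τ * s x ^ ((1 + m : ℝ) / 2) * ‖u x‖ ^ 2 := by
              ring
          _ = _ := by
              rw [← Real.rpow_add (hpos x hxc), ← Real.rpow_add (hpos x hxc), sub_add_eq_add_sub,
                neg_add_cancel, zero_sub, neg_add_cancel, Real.rpow_zero, one_mul]
      have h2 := mul_le_mul_of_nonneg_left ((le_abs_self _).trans (hD x hxc))
        (mul_nonneg (Real.rpow_nonneg (hpos x hxc).le (-τ - (1 + m) / 2)) (sq_nonneg ‖W x‖))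
      linarith
    · simp [image_eq_zero_of_notMem_tsupport hx, hW0 x hx]
  have hright : ∫ x, s x ^ (-τ - (1 + m) / 2) * (s x * ‖lap W x‖) ^ 2 ≤
      E * ∫ x in Ω, ‖zf x ^ (-(τ : ℂ)) * lap W x‖ ^ 2 := by
    have hl : ∀ x ∉ tsupport u, lap W x = 0 := fun x hx =>
      lap_eq_zero_of_notMem_tsupport fun h => hx (hsub h)
    have hz : ∀ x ∉ tsupport u, ‖zf x ^ (-(τ : ℂ)) * lap W x‖ ^ 2 = 0 := fun x hx => by
      simp [hl x hx]
    have hG : Integrable fun x => ‖zf x ^ (-(τ : ℂ)) * lap W x‖ ^ 2 :=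
      integrable_of_continuousAt_tsupport huc hz fun x hx =>
        (((contDiffAt_zf_cpow (hΩline x (subset_closure (hut hx))) _ (k := 0)).continuousAt.mul
          (continuous_lap hWs).continuousAt).norm.pow 2)
    rw [setIntegral_eq_integral_of_forall_compl_eq_zero fun x hx => hz x fun h => hx (hut h),
      ← integral_const_mul]
    refine integral_mono hB (hG.const_mul E) fun x => ?_
    by_cases hx : x ∈ tsupport u
    · have hxc : x ∈ closure Ω := subset_closure (hut hx)
      have h1 : s x ^ (-τ - (1 + m) / 2) * (s x * ‖lap W x‖) ^ 2 =
          ‖zf x ^ (-(τ : ℂ)) * lap W x‖ ^ 2 * s x ^ (2 - (1 + m : ℝ) / 2) := by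
        rw [norm_mul, mul_pow, mul_pow, ← Complex.ofReal_neg, hnorm, ← Real.rpow_two (s x)]
        calc _ = s x ^ (-τ - (1 + m) / 2) * s x ^ (2 : ℝ) * ‖lap W x‖ ^ 2 := by ring
          _ = s x ^ (-τ) * s x ^ (2 - (1 + m : ℝ) / 2) * ‖lap W x‖ ^ 2 := by
              rw [← Real.rpow_add (hpos x hxc), ← Real.rpow_add (hpos x hxc)]
              ring_nf
          _ = _ := by ring
      have h2 := mul_le_mul_of_nonneg_left ((le_abs_self _).trans (hE x hxc))
        (sq_nonneg ‖zf x ^ (-(τ : ℂ)) * lap W x‖)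
      exact h1.le.trans (h2.trans_eq (mul_comm _ _))
    · simp [hl x hx]
  have hτK : τ ^ 2 ≤ (2 * τ + m - 1) ^ 2 := by
    have hm : (0 : ℝ) ≤ m := m.cast_nonneg
    rcases le_abs'.1 hτ with h | h
    · nlinarith [mul_nonneg (show 0 ≤ -(τ + m - 1) by linarith)
        (show 0 ≤ -(3 * τ + m - 1) by linarith)]
    · nlinarith [mul_nonneg (show 0 ≤ τ + m - 1 by linarith)
        (show 0 ≤ 3 * τ + m - 1 by linarith)]
  have hA0 : 0 ≤ ∫ x in Ω, ‖u x‖ ^ 2 := integral_nonneg fun x => by positivity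
  have hG0 : 0 ≤ ∫ x in Ω, ‖zf x ^ (-(τ : ℂ)) * lap W x‖ ^ 2 :=
    integral_nonneg fun x => by positivity
  rw [← Real.sqrt_sq_eq_abs, ← Real.sqrt_mul (sq_nonneg τ), ← Real.sqrt_mul (by positivity)]
  refine Real.sqrt_le_sqrt ?_
  calc τ ^ 2 * ∫ x in Ω, ‖u x‖ ^ 2
      ≤ (2 * τ + m - 1) ^ 2 * (D * ∫ x, s x ^ (-τ - (1 + m) / 2) * ‖W x‖ ^ 2) :=
        mul_le_mul hτK hleft hA0 (sq_nonneg _)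
    _ = D * ((2 * τ + m - 1) ^ 2 * ∫ x, s x ^ (-τ - (1 + m) / 2) * ‖W x‖ ^ 2) := by ring
    _ ≤ D * (M * (E * ∫ x in Ω, ‖zf x ^ (-(τ : ℂ)) * lap W x‖ ^ 2)) :=
        mul_le_mul_of_nonneg_left (hAB.trans (mul_le_mul_of_nonneg_left hright hM0)) hD0
    _ ≤ (D * M * E + 1) * ∫ x in Ω, ‖zf x ^ (-(τ : ℂ)) * lap W x‖ ^ 2 := by linarith

end Split

/-- Interior Carleman estimate for the conjugated Laplacian `z^{-τ} Δ z^{τ}`. -/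
theorem carleman_estimate (n : ℕ) (hn : 3 ≤ n) (Ω : Set (Spc (n - 1)))
    (hΩopen : IsOpen Ω) (hΩne : Ω.Nonempty) (hΩbdd : Bornology.IsBounded Ω)
    (hΩline : ∀ x ∈ closure Ω, x.2 ≠ 0) :
    ∃ C > (0 : ℝ), ∃ τ₀ ≥ (1 : ℝ), ∀ τ : ℝ, τ₀ ≤ |τ| →
      ∀ u : Spc (n - 1) → ℂ, ContDiff ℝ (⊤ : ℕ∞) u → HasCompactSupport u → tsupport u ⊆ Ω →
        |τ| * Real.sqrt (∫ x in Ω, ‖u x‖ ^ 2) ≤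
          C * Real.sqrt (∫ x in Ω,
            ‖zf x ^ (-(τ : ℂ)) * lap (fun y => zf y ^ (τ : ℂ) * u y) x‖ ^ 2) := by
  exact exists_carleman_constant hΩne hΩbdd hΩline
end
end

section
/- Let U be an open subset of {x ∈ ℝⁿ : x' ≠ 0}, let u : U → ℂ be twice continuously differentiable, and let τ ∈ ℝ. Then for every x ∈ U, Δ(z^τ u)(x) = z(x)^τ · [ Δu(x) + τ·( (4 / z(x)) · ∂_z̄u(x) − (2(n−2) / ((z(x) − z̄(x))·z(x))) · u(x) ) ], where ∂_z̄u(x) := ½·( ∂u/∂x₁(x) + i·(x'/|x'|)·∇_{x'}u(x) ) (with ∇_{x'} the gradient in the x' variables) and z(x) − z̄(x) = 2i·|x'|. In particular there is no τ² term: z^{−τ} Δ z^τ = Δ + τ·((4/z)∂_z̄ − 2(n−2)/((z−z̄)z)). -/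
open MeasureTheory Complex

noncomputable section

/-- `∂_z̄ f(x) = ½ (∂f/∂x₁(x) + i (x'/|x'|)·∇_{x'} f(x))`. -/
def dbar {m : ℕ} (f : Spc m → ℂ) (x : Spc m) : ℂ :=
  (1 / 2 : ℂ) * (fderiv ℝ f x ((1 : ℝ), 0) + Complex.I * fderiv ℝ f x (0, ‖x.2‖⁻¹ • x.2))

/-- The derivative of `zf` in the direction `v`. -/
def zfDeriv {m : ℕ} (v x : Spc m) : ℂ :=
  (v.1 : ℂ) + Complex.I * ((‖x.2‖⁻¹ * inner ℝ x.2 v.2 : ℝ) : ℂ)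

lemma hasFDerivAt_norm_snd {m : ℕ} {x : Spc m} (hx : x.2 ≠ 0) :
    HasFDerivAt (fun y : Spc m => ‖y.2‖)
      (‖x.2‖⁻¹ • (innerSL ℝ x.2).comp (ContinuousLinearMap.snd ℝ ℝ _)) x := by
  have hr : ‖x.2‖ ≠ 0 := norm_ne_zero_iff.mpr hx
  have h := (((hasFDerivAt_id x.2).norm_sq).sqrt (by simpa using hr)).comp x hasFDerivAt_snd
  simp only [id, Real.sqrt_sq (norm_nonneg _)] at h
  refine h.congr_fderiv ?_
  ext v
  · simp
  · simp
    field_simp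

lemma hasFDerivAt_zf {m : ℕ} {x : Spc m} (hx : x.2 ≠ 0) :
    ∃ L : Spc m →L[ℝ] ℂ, HasFDerivAt zf L x ∧ ∀ v, L v = zfDeriv v x := by
  have h1 := Complex.ofRealCLM.hasFDerivAt.comp x (hasFDerivAt_fst (𝕜 := ℝ) (p := x))
  have h2 := Complex.ofRealCLM.hasFDerivAt.comp x (hasFDerivAt_norm_snd hx)
  refine ⟨_, h1.add (h2.const_mul Complex.I), fun v => ?_⟩
  simp [zfDeriv]

lemma hasFDerivAt_zfDeriv {m : ℕ} (v : Spc m) {x : Spc m} (hx : x.2 ≠ 0) :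
    ∃ L : Spc m →L[ℝ] ℂ, HasFDerivAt (zfDeriv v) L x ∧
      L v = Complex.I * ((‖x.2‖⁻¹ * ‖v.2‖ ^ 2 - ‖x.2‖⁻¹ ^ 3 * inner ℝ x.2 v.2 ^ 2 : ℝ) : ℂ) := by
  have hr : ‖x.2‖ ≠ 0 := norm_ne_zero_iff.mpr hx
  have h1 := (hasDerivAt_inv hr).comp_hasFDerivAt x (hasFDerivAt_norm_snd hx)
  have h2 := (hasFDerivAt_snd (𝕜 := ℝ) (p := x)).inner ℝ (hasFDerivAt_const v.2 x)
  have h3 := Complex.ofRealCLM.hasFDerivAt.comp x (h1.mul h2)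
  refine ⟨_, (h3.const_mul Complex.I).const_add (v.1 : ℂ), ?_⟩
  simp [fderivInnerCLM_apply]
  field_simp
  ring_nf

lemma zf_mem_slitPlane {m : ℕ} {x : Spc m} (hx : x.2 ≠ 0) : zf x ∈ Complex.slitPlane := by
  right
  simpa [zf] using hx

lemma hasFDerivAt_zf_cpow {m : ℕ} (c : ℂ) {x : Spc m} (hx : x.2 ≠ 0) :
    ∃ L : Spc m →L[ℝ] ℂ, HasFDerivAt (fun y => zf y ^ c) L x ∧
      ∀ v, L v = c * zf x ^ (c - 1) * zfDeriv v x := by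
  obtain ⟨L, hL, hLv⟩ := hasFDerivAt_zf hx
  have h := ((Complex.hasStrictDerivAt_cpow_const (c := c)
    (zf_mem_slitPlane hx)).hasDerivAt).comp_hasFDerivAt_of_eq x hL rfl
  exact ⟨_, h, fun v => by simp [hLv]⟩

lemma fderiv_fderiv_zf_cpow_mul {m : ℕ} {u : Spc m → ℂ} {x : Spc m} (hx : x.2 ≠ 0)
    (hu : ContDiffAt ℝ 2 u x) (c : ℂ) (v : Spc m) :
    fderiv ℝ (fun y => fderiv ℝ (fun w => zf w ^ c * u w) y v) x v =
      zf x ^ c * fderiv ℝ (fun y => fderiv ℝ u y v) x v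
      + 2 * c * zf x ^ (c - 1) * (zfDeriv v x * fderiv ℝ u x v)
      + c * (c - 1) * zf x ^ (c - 2) * u x * zfDeriv v x ^ 2
      + c * zf x ^ (c - 1) * u x * (Complex.I *
          ((‖x.2‖⁻¹ * ‖v.2‖ ^ 2 - ‖x.2‖⁻¹ ^ 3 * inner ℝ x.2 v.2 ^ 2 : ℝ) : ℂ)) := by
  have hev : (fun y => fderiv ℝ (fun w => zf w ^ c * u w) y v) =ᶠ[nhds x]
      fun y => zf y ^ c * fderiv ℝ u y v + u y * (c * zf y ^ (c - 1) * zfDeriv v y) := by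
    filter_upwards [hu.eventually (by simp), continuousAt_snd.eventually_ne hx] with y hy hy0
    obtain ⟨L, hL, hLv⟩ := hasFDerivAt_zf_cpow c hy0
    have h : HasFDerivAt (fun w => zf w ^ c * u w) _ y :=
      hL.mul (hy.differentiableAt (by simp)).hasFDerivAt
    rw [h.fderiv]
    simp [hLv]
  obtain ⟨L, hL, hLv⟩ := hasFDerivAt_zf_cpow c hx
  obtain ⟨M, hM, hMv⟩ := hasFDerivAt_zf_cpow (c - 1) hx
  obtain ⟨N, hN, hNv⟩ := hasFDerivAt_zfDeriv v hx
  have hdu : DifferentiableAt ℝ (fun y => fderiv ℝ u y v) x :=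
    ((hu.fderiv_right (m := 1) (by norm_num)).differentiableAt (by simp)).clm_apply
      (differentiableAt_const v)
  have h : HasFDerivAt
      (fun y => zf y ^ c * fderiv ℝ u y v + u y * (c * zf y ^ (c - 1) * zfDeriv v y)) _ x :=
    (hL.mul hdu.hasFDerivAt).add
      ((hu.differentiableAt (by simp)).hasFDerivAt.mul ((hM.const_mul c).mul hN))
  rw [hev.fderiv_eq, h.fderiv]
  simp only [add_apply, smul_apply, smul_eq_mul, hLv, hMv, hNv]
  rw [show c - 1 - 1 = c - 2 by ring]
  ring

lemma sum_inner_single_sq {m : ℕ} (a : EuclideanSpace ℝ (Fin m)) :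
    ∑ i, inner ℝ a (EuclideanSpace.single i (1 : ℝ)) ^ 2 = ‖a‖ ^ 2 := by
  simp [EuclideanSpace.norm_sq_eq, EuclideanSpace.inner_single_right]

lemma sum_inner_single_mul {m : ℕ} (L : Spc m →L[ℝ] ℂ) (a : EuclideanSpace ℝ (Fin m)) :
    ∑ i, (inner ℝ a (EuclideanSpace.single i (1 : ℝ)) : ℂ) *
      L (0, EuclideanSpace.single i (1 : ℝ)) = L (0, a) := by
  have h : (0, a) = ∑ i, a i • ((0, EuclideanSpace.single i (1 : ℝ)) : Spc m) := by
    ext j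
    · simp [Prod.fst_sum]
    · simp [Prod.snd_sum, Finset.sum_apply, Pi.single_apply]
  rw [h, map_sum]
  simp only [map_smul]
  simp [EuclideanSpace.inner_single_right]

lemma sum_zfDeriv_sq {m : ℕ} {x : Spc m} (hx : x.2 ≠ 0) :
    zfDeriv (1, 0) x ^ 2 + ∑ i, zfDeriv (0, EuclideanSpace.single i (1 : ℝ)) x ^ 2 = 0 := by
  have hr : ‖x.2‖ ≠ 0 := norm_ne_zero_iff.mpr hx
  have h : ∑ i, zfDeriv (0, EuclideanSpace.single i (1 : ℝ)) x ^ 2 =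
      ((-(‖x.2‖⁻¹ ^ 2 * ∑ i, inner ℝ x.2 (EuclideanSpace.single i (1 : ℝ)) ^ 2) : ℝ) : ℂ) := by
    simp [zfDeriv, mul_pow, Finset.mul_sum]
  rw [h, sum_inner_single_sq, inv_pow, inv_mul_cancel₀ (pow_ne_zero 2 hr)]
  simp [zfDeriv]

lemma sum_zfDeriv_mul {m : ℕ} (L : Spc m →L[ℝ] ℂ) (x : Spc m) :
    zfDeriv (1, 0) x * L (1, 0) + ∑ i, zfDeriv (0, EuclideanSpace.single i (1 : ℝ)) x *
      L (0, EuclideanSpace.single i (1 : ℝ)) =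
    L (1, 0) + Complex.I * L (0, ‖x.2‖⁻¹ • x.2) := by
  rw [← sum_inner_single_mul, Finset.mul_sum]
  simp [zfDeriv, inner_smul_left, mul_assoc]

lemma sum_zf_second_deriv {m : ℕ} {x : Spc m} (hx : x.2 ≠ 0) :
    ∑ i : Fin m, (‖x.2‖⁻¹ * ‖EuclideanSpace.single i (1 : ℝ)‖ ^ 2
      - ‖x.2‖⁻¹ ^ 3 * inner ℝ x.2 (EuclideanSpace.single i (1 : ℝ)) ^ 2) =
    (m - 1) * ‖x.2‖⁻¹ := by
  have hr : ‖x.2‖ ≠ 0 := norm_ne_zero_iff.mpr hx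
  rw [Finset.sum_sub_distrib, ← Finset.mul_sum, ← Finset.mul_sum, sum_inner_single_sq]
  simp
  field_simp

lemma lap_zf_cpow_mul {m : ℕ} {u : Spc m → ℂ} {x : Spc m} (hx : x.2 ≠ 0)
    (hu : ContDiffAt ℝ 2 u x) (c : ℂ) :
    lap (fun y => zf y ^ c * u y) x =
      zf x ^ c * lap u x + 4 * c * zf x ^ (c - 1) * dbar u x
      + c * zf x ^ (c - 1) * u x * (Complex.I * (((m - 1) * ‖x.2‖⁻¹ : ℝ) : ℂ)) := by
  have h1 := sum_zfDeriv_sq hx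
  have h2 := sum_zfDeriv_mul (fderiv ℝ u x) x
  rw [← sum_zf_second_deriv hx]
  simp only [lap, dbar, fderiv_fderiv_zf_cpow_mul hx hu, Finset.sum_add_distrib,
    ← Finset.mul_sum, Complex.ofReal_sum]
  simp only [norm_zero, inner_zero_right]
  push_cast
  linear_combination (2 * c * zf x ^ (c - 1)) * h2 + (c * (c - 1) * zf x ^ (c - 2) * u x) * h1

/-- The conjugated Laplacian `z^{-τ} Δ z^{τ}` equals `Δ + τ ((4/z) ∂_z̄ − 2(n−2)/((z−z̄)z))`;
in particular there is no `τ²` term. -/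
theorem conjugated_laplacian_formula (n : ℕ) (hn : 3 ≤ n) (U : Set (Spc (n - 1)))
    (hU : IsOpen U) (hU0 : ∀ x ∈ U, x.2 ≠ 0)
    (u : Spc (n - 1) → ℂ) (hu : ContDiffOn ℝ 2 u U) (τ : ℝ) :
    ∀ x ∈ U,
      lap (fun y => zf y ^ (τ : ℂ) * u y) x =
        zf x ^ (τ : ℂ) *
          (lap u x + (τ : ℂ) * ((4 / zf x) * dbar u x -
            (2 * ((n : ℂ) - 2) / ((zf x - (starRingEnd ℂ) (zf x)) * zf x)) * u x)) := by
  intro x hxU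
  have hx := hU0 x hxU
  have hr : (‖x.2‖ : ℂ) ≠ 0 := by exact_mod_cast norm_ne_zero_iff.mpr hx
  have hz : zf x ≠ 0 := Complex.slitPlane_ne_zero (zf_mem_slitPlane hx)
  have hconj : zf x - (starRingEnd ℂ) (zf x) = 2 * Complex.I * ‖x.2‖ := by
    simp [zf]
    ring
  rw [lap_zf_cpow_mul hx (hu.contDiffAt (hU.mem_nhds hxU)), hconj,
    Complex.cpow_sub _ _ hz, Complex.cpow_one]
  push_cast [Nat.cast_sub (show 1 ≤ n by omega)]
  field_simp
  linear_combination (zf x ^ (τ : ℂ) * τ * u x * (n - 2)) * Complex.I_sq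
end
end
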